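/- Let n be a positive integer. The map sending an orbit of the SL₂(ℤ)-action on (ℤ/nℤ)² to the common value of g on that orbit, where g(p,q) = gcd(p̃, gcd(q̃, n)) with p̃, q̃ ∈ {0,…,n−1} the canonical integer representatives, is a bijection from the set of orbits onto the set of positive divisors of n. In particular, the number of orbits equals the number of positive divisors of n. -/

import Mathlib

/-- The action of `SL₂(ℤ)` on `(ℤ/nℤ)²`: reduce the matrix entries modulo `n` and
multiply the column vector `(v.1, v.2)`. -/
def sl2Smul (n : ℕ) (M : Matrix.SpecialLinearGroup (Fin 2) ℤ) (v : ZMod n × ZMod n) :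
    ZMod n × ZMod n :=
  (((M.1 0 0 : ℤ) : ZMod n) * v.1 + ((M.1 0 1 : ℤ) : ZMod n) * v.2,
   ((M.1 1 0 : ℤ) : ZMod n) * v.1 + ((M.1 1 1 : ℤ) : ZMod n) * v.2)

/-- `g(p,q) = gcd(p̃, gcd(q̃, n))`, where `p̃, q̃ ∈ {0,…,n−1}` are the canonical
integer representatives of `p` and `q`. -/
def gInv (n : ℕ) (v : ZMod n × ZMod n) : ℕ :=
  Nat.gcd v.1.val (Nat.gcd v.2.val n)

lemma sl2Smul_one (n : ℕ) (v : ZMod n × ZMod n) : sl2Smul n 1 v = v := by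
  simp [sl2Smul, Matrix.SpecialLinearGroup.coe_one, Matrix.one_apply]

lemma sl2Smul_mul (n : ℕ) (M N : Matrix.SpecialLinearGroup (Fin 2) ℤ)
    (v : ZMod n × ZMod n) :
    sl2Smul n (M * N) v = sl2Smul n M (sl2Smul n N v) := by
  simp only [sl2Smul, Matrix.SpecialLinearGroup.coe_mul, Matrix.mul_apply,
    Fin.sum_univ_two]
  refine Prod.ext ?_ ?_ <;> push_cast <;> ring

/-- Two elements of `(ℤ/nℤ)²` are equivalent if they lie in the same orbit of the
`SL₂(ℤ)`-action. -/
def sl2OrbitSetoid (n : ℕ) : Setoid (ZMod n × ZMod n) where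
  r v w := ∃ M : Matrix.SpecialLinearGroup (Fin 2) ℤ, sl2Smul n M v = w
  iseqv := by
    refine ⟨fun v => ⟨1, sl2Smul_one n v⟩, ?_, ?_⟩
    · rintro v w ⟨M, rfl⟩
      exact ⟨M⁻¹, by rw [← sl2Smul_mul, inv_mul_cancel, sl2Smul_one]⟩
    · rintro v w u ⟨M, rfl⟩ ⟨N, rfl⟩
      exact ⟨N * M, sl2Smul_mul n N M v⟩

lemma dvd_gInv_iff {n d : ℕ} [NeZero n] (hd : d ∣ n) (v : ZMod n × ZMod n) :
    d ∣ gInv n v ↔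
      ZMod.castHom hd (ZMod d) v.1 = 0 ∧ ZMod.castHom hd (ZMod d) v.2 = 0 := by
  have key (x : ZMod n) : ZMod.castHom hd (ZMod d) x = 0 ↔ d ∣ x.val := by
    rw [← ZMod.natCast_eq_zero_iff, ZMod.castHom_apply, ZMod.natCast_val]
  rw [key, key, gInv, Nat.dvd_gcd_iff, Nat.dvd_gcd_iff]
  tauto

lemma gInv_dvd (n : ℕ) (v : ZMod n × ZMod n) : gInv n v ∣ n :=
  (Nat.gcd_dvd_right _ _).trans (Nat.gcd_dvd_right _ _)

lemma gInv_dvd_gInv_sl2Smul (n : ℕ) [NeZero n] (M : Matrix.SpecialLinearGroup (Fin 2) ℤ)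
    (v : ZMod n × ZMod n) : gInv n v ∣ gInv n (sl2Smul n M v) := by
  have hd := gInv_dvd n v
  obtain ⟨h₁, h₂⟩ := (dvd_gInv_iff hd v).1 dvd_rfl
  rw [dvd_gInv_iff hd]
  simp only [sl2Smul, map_add, map_mul, h₁, h₂, mul_zero, add_zero, and_self]

lemma gInv_eq_of_sl2OrbitSetoid {n : ℕ} [NeZero n] {v w : ZMod n × ZMod n}
    (h : (sl2OrbitSetoid n).r v w) : gInv n v = gInv n w := by
  have dvd {v w : ZMod n × ZMod n} (h : (sl2OrbitSetoid n).r v w) : gInv n v ∣ gInv n w := by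
    obtain ⟨M, rfl⟩ := h
    exact gInv_dvd_gInv_sl2Smul n M v
  exact Nat.dvd_antisymm (dvd h) (dvd ((sl2OrbitSetoid n).symm h))

/-- Modulo `n`, the Euclidean algorithm moves `(a, b)` to `(gcd a b, 0)`. -/
lemma sl2OrbitSetoid_gcd (n a b : ℕ) :
    (sl2OrbitSetoid n).r ((a : ZMod n), (b : ZMod n)) ((Nat.gcd a b : ZMod n), 0) := by
  rcases Nat.eq_zero_or_pos (Nat.gcd a b) with h | h
  · obtain ⟨rfl, rfl⟩ := Nat.gcd_eq_zero_iff.1 h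
    exact ⟨1, by simp [sl2Smul_one]⟩
  · obtain ⟨a', ha⟩ := Nat.gcd_dvd_left a b
    obtain ⟨b', hb⟩ := Nat.gcd_dvd_right a b
    have bez := Nat.gcd_eq_gcd_ab a b
    generalize Nat.gcdA a b = s at bez
    generalize Nat.gcdB a b = t at bez
    generalize Nat.gcd a b = g at *
    subst ha hb
    have hst : s * a' + t * b' = 1 := by
      have hg : (g : ℤ) ≠ 0 := by exact_mod_cast h.ne'
      apply mul_left_cancel₀ hg
      push_cast at bez
      linear_combination -bez
    refine ⟨⟨!![s, t; -b', a'], by rw [Matrix.det_fin_two_of]; linear_combination hst⟩, ?_⟩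
    have hst' : (s : ZMod n) * a' + t * b' = 1 := by
      exact_mod_cast congrArg (Int.cast (R := ZMod n)) hst
    refine Prod.ext ?_ ?_
    · simp [sl2Smul]
      linear_combination (g : ZMod n) * hst'
    · simp [sl2Smul]
      ring

lemma sl2OrbitSetoid_gInv (n : ℕ) [NeZero n] (v : ZMod n × ZMod n) :
    (sl2OrbitSetoid n).r v ((gInv n v : ZMod n), 0) := by
  have h₁ := sl2OrbitSetoid_gcd n v.1.val v.2.val
  have h₂ := sl2OrbitSetoid_gcd n (Nat.gcd v.1.val v.2.val) n
  rw [ZMod.natCast_zmod_val, ZMod.natCast_zmod_val] at h₁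
  rw [ZMod.natCast_self, Nat.gcd_assoc] at h₂
  exact (sl2OrbitSetoid n).trans h₁ h₂

lemma gInv_natCast_zero {n d : ℕ} (hd : d ∣ n) : gInv n ((d : ZMod n), 0) = d := by
  rw [gInv, ZMod.val_natCast, ZMod.val_zero, Nat.gcd_zero_left, ← Nat.gcd_rec, Nat.gcd_comm,
    Nat.gcd_eq_left hd]

theorem sl2_orbits_biject_with_divisors (n : ℕ) (hn : 0 < n) :
    ∃ e : Quotient (sl2OrbitSetoid n) ≃ {d : ℕ // 0 < d ∧ d ∣ n},
      ∀ v : ZMod n × ZMod n, (e (Quotient.mk (sl2OrbitSetoid n) v)).1 = gInv n v := by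
  have : NeZero n := ⟨hn.ne'⟩
  let f : Quotient (sl2OrbitSetoid n) → {d : ℕ // 0 < d ∧ d ∣ n} :=
    Quotient.lift (fun v => ⟨gInv n v, Nat.pos_of_dvd_of_pos (gInv_dvd n v) hn, gInv_dvd n v⟩)
      fun _ _ h => Subtype.ext (gInv_eq_of_sl2OrbitSetoid h)
  refine ⟨Equiv.ofBijective f ⟨?_, ?_⟩, fun v => rfl⟩
  · rintro ⟨v⟩ ⟨w⟩ h
    have hvw : gInv n v = gInv n w := congrArg Subtype.val h
    apply Quotient.sound
    have hw := sl2OrbitSetoid_gInv n w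
    rw [← hvw] at hw
    exact (sl2OrbitSetoid n).trans (sl2OrbitSetoid_gInv n v) ((sl2OrbitSetoid n).symm hw)
  · rintro ⟨d, -, hd⟩
    exact ⟨Quotient.mk _ ((d : ZMod n), 0), Subtype.ext (gInv_natCast_zero hd)⟩
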